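/- arXiv:1009.2978 — 3 statements merged into one kernel-verified Lean document; each statement's English description precedes it below -/
import Mathlib

section
/- Let n ≥ 0, and let (q,p) ∈ ℍⁿ × ℍ satisfy |q|² + |p|² = 1 and p ≠ −1. Define q' = (1+p)⁻¹ q (componentwise left multiplication by the quaternion (1+p)⁻¹) and p' = (1+p)⁻¹ (1−p). Then Re p' = |q'|²; that is, the Cayley transform maps the unit sphere in ℍⁿ × ℍ minus the point (0,−1) into the boundary Σ = { (q',p') ∈ ℍⁿ × ℍ : Re p' = |q'|² } of the quaternionic Siegel domain. -/
open scoped Quaternion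

/-- The real part of the Cayley transform `(1 + p)⁻¹ * (1 - p)` of a quaternion. -/
theorem Quaternion.re_cayley (p : ℍ[ℝ]) :
    ((1 + p)⁻¹ * (1 - p)).re = (‖1 + p‖ ^ 2)⁻¹ * (1 - ‖p‖ ^ 2) := by
  rw [Quaternion.instInv]
  simp only [pow_two, ← Quaternion.normSq_eq_norm_mul_self, smul_mul_assoc, Quaternion.re_smul,
    smul_eq_mul]
  congr 1
  simp only [Quaternion.normSq_def', Quaternion.re_mul, Quaternion.re_star, Quaternion.imI_star,
    Quaternion.imJ_star, Quaternion.imK_star, Quaternion.re_add, Quaternion.imI_add,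
    Quaternion.imJ_add, Quaternion.imK_add, Quaternion.re_sub, Quaternion.imI_sub,
    Quaternion.imJ_sub, Quaternion.imK_sub, Quaternion.re_one, Quaternion.imI_one,
    Quaternion.imJ_one, Quaternion.imK_one]
  ring

/-- the Cayley transform maps the sphere minus a point into the boundary
of the quaternionic Siegel domain.  Let `(q,p) ∈ ℍⁿ × ℍ` with `|q|² + |p|² = 1` and
`p ≠ −1`.  If `q' = (1+p)⁻¹ q` and `p' = (1+p)⁻¹ (1−p)`, then `Re p' = |q'|²`. -/
theorem cayley_maps_sphere_to_siegel_boundary (n : ℕ)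
    (q : Fin n → ℍ[ℝ]) (p : ℍ[ℝ])
    (hsphere : (∑ i : Fin n, ‖q i‖ ^ 2) + ‖p‖ ^ 2 = 1)
    (hp : p ≠ -1)
    (q' : Fin n → ℍ[ℝ]) (p' : ℍ[ℝ])
    (hq' : q' = fun i => (1 + p)⁻¹ * q i)
    (hp' : p' = (1 + p)⁻¹ * (1 - p)) :
    p'.re = ∑ i : Fin n, ‖q' i‖ ^ 2 := by
  subst hq' hp'
  simp only [Quaternion.re_cayley, norm_mul, norm_inv, mul_pow, inv_pow, ← Finset.mul_sum]
  rw [← hsphere, add_sub_cancel_right]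
end

section
/- Let n ≥ 1, Q = 4n+6, and define Φ: ℝ^{4n+3} → ℝ by Φ(q,ω) = 8^{(Q−2)/4} [(1+|q|²)² + |ω|²]^{−(Q−2)/4} = 8^{n+1} [(1+|q|²)² + |ω|²]^{−(n+1)}. Then Φ solves the qc Yamabe equation on the quaternionic Heisenberg group: ΔΦ = −K Φ^{(Q+2)/(Q−2)}, where K = (Q−2)(Q−6)/8 = 2n(n+1). -/
open MeasureTheory Real

/-- The quaternionic Heisenberg group `G(ℍ) = ℍⁿ × Im ℍ`, identified with `ℝ^{4n+3}`:
a point is `(q, ω)` where `q α = (t_α, x_α, y_α, z_α)` are the coordinates of the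
quaternion `q_α = t_α + i x_α + j y_α + k z_α`, and `ω = (x, y, z)` are the coordinates
of `ω = ix + jy + kz ∈ Im ℍ`. -/
abbrev QH (n : ℕ) : Type := (Fin n → ℝ × ℝ × ℝ × ℝ) × (ℝ × ℝ × ℝ)

namespace QH

/-- `t`-coordinate of a quaternion quadruple. -/
def tC (a : ℝ × ℝ × ℝ × ℝ) : ℝ := a.1
/-- `x`-coordinate of a quaternion quadruple. -/
def xC (a : ℝ × ℝ × ℝ × ℝ) : ℝ := a.2.1
/-- `y`-coordinate of a quaternion quadruple. -/
def yC (a : ℝ × ℝ × ℝ × ℝ) : ℝ := a.2.2.1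
/-- `z`-coordinate of a quaternion quadruple. -/
def zC (a : ℝ × ℝ × ℝ × ℝ) : ℝ := a.2.2.2

/-- The value at `g` of the left-invariant vector field
`T_α = ∂_{t_α} + 2x_α ∂_x + 2y_α ∂_y + 2z_α ∂_z`, as a tangent vector. -/
def Tvec (n : ℕ) (α : Fin n) (g : QH n) : QH n :=
  (Pi.single α (1, 0, 0, 0),
    (2 * xC (g.1 α), 2 * yC (g.1 α), 2 * zC (g.1 α)))

/-- The value at `g` of `X_α = ∂_{x_α} − 2t_α ∂_x − 2z_α ∂_y + 2y_α ∂_z`. -/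
def Xvec (n : ℕ) (α : Fin n) (g : QH n) : QH n :=
  (Pi.single α (0, 1, 0, 0),
    (-2 * tC (g.1 α), -2 * zC (g.1 α), 2 * yC (g.1 α)))

/-- The value at `g` of `Y_α = ∂_{y_α} + 2z_α ∂_x − 2t_α ∂_y − 2x_α ∂_z`. -/
def Yvec (n : ℕ) (α : Fin n) (g : QH n) : QH n :=
  (Pi.single α (0, 0, 1, 0),
    (2 * zC (g.1 α), -2 * tC (g.1 α), -2 * xC (g.1 α)))

/-- The value at `g` of `Z_α = ∂_{z_α} − 2y_α ∂_x + 2x_α ∂_y − 2t_α ∂_z`. -/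
def Zvec (n : ℕ) (α : Fin n) (g : QH n) : QH n :=
  (Pi.single α (0, 0, 0, 1),
    (-2 * yC (g.1 α), 2 * xC (g.1 α), -2 * tC (g.1 α)))

/-- Derivative of `u` along `T_α`. -/
noncomputable def TD (n : ℕ) (α : Fin n) (u : QH n → ℝ) (g : QH n) : ℝ :=
  fderiv ℝ u g (Tvec n α g)
/-- Derivative of `u` along `X_α`. -/
noncomputable def XD (n : ℕ) (α : Fin n) (u : QH n → ℝ) (g : QH n) : ℝ :=
  fderiv ℝ u g (Xvec n α g)
/-- Derivative of `u` along `Y_α`. -/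
noncomputable def YD (n : ℕ) (α : Fin n) (u : QH n → ℝ) (g : QH n) : ℝ :=
  fderiv ℝ u g (Yvec n α g)
/-- Derivative of `u` along `Z_α`. -/
noncomputable def ZD (n : ℕ) (α : Fin n) (u : QH n → ℝ) (g : QH n) : ℝ :=
  fderiv ℝ u g (Zvec n α g)

/-- Square of the length of the horizontal gradient:
`|∇u|² = Σ_α ((T_α u)² + (X_α u)² + (Y_α u)² + (Z_α u)²)`. -/
noncomputable def hGradSq (n : ℕ) (u : QH n → ℝ) (g : QH n) : ℝ :=
  ∑ α : Fin n, ((TD n α u g) ^ 2 + (XD n α u g) ^ 2 + (YD n α u g) ^ 2 + (ZD n α u g) ^ 2)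

/-- The sub-Laplacian `Δu = Σ_α (T_α(T_α u) + X_α(X_α u) + Y_α(Y_α u) + Z_α(Z_α u))`. -/
noncomputable def subLap (n : ℕ) (u : QH n → ℝ) (g : QH n) : ℝ :=
  ∑ α : Fin n, (TD n α (TD n α u) g + XD n α (XD n α u) g
    + YD n α (YD n α u) g + ZD n α (ZD n α u) g)

/-- `|q|² = Σ_α (t_α² + x_α² + y_α² + z_α²)`. -/
def qSq (n : ℕ) (g : QH n) : ℝ :=
  ∑ α : Fin n, ((tC (g.1 α)) ^ 2 + (xC (g.1 α)) ^ 2 + (yC (g.1 α)) ^ 2 + (zC (g.1 α)) ^ 2)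

/-- `|ω|² = x² + y² + z²`. -/
def wSq (n : ℕ) (g : QH n) : ℝ := g.2.1 ^ 2 + g.2.2.1 ^ 2 + g.2.2.2 ^ 2

/-- `i`-component of `Im (a·b̄)` for quaternions given as coordinate quadruples. -/
def imI (a b : ℝ × ℝ × ℝ × ℝ) : ℝ :=
  -tC a * xC b + xC a * tC b - yC a * zC b + zC a * yC b

/-- `j`-component of `Im (a·b̄)`. -/
def imJ (a b : ℝ × ℝ × ℝ × ℝ) : ℝ :=
  -tC a * yC b + xC a * zC b + yC a * tC b - zC a * xC b

/-- `k`-component of `Im (a·b̄)`. -/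
def imK (a b : ℝ × ℝ × ℝ × ℝ) : ℝ :=
  -tC a * zC b - xC a * yC b + yC a * xC b + zC a * tC b

/-- The group law `(q₀,ω₀)∘(q,ω) = (q₀+q, ω+ω₀+2 Im(q₀ q̄))`. -/
def op (n : ℕ) (a g : QH n) : QH n :=
  (a.1 + g.1,
    (g.2.1 + a.2.1 + 2 * ∑ α : Fin n, imI (a.1 α) (g.1 α),
     g.2.2.1 + a.2.2.1 + 2 * ∑ α : Fin n, imJ (a.1 α) (g.1 α),
     g.2.2.2 + a.2.2.2 + 2 * ∑ α : Fin n, imK (a.1 α) (g.1 α)))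

/-- The anisotropic dilations `δ_λ(q,ω) = (λq, λ²ω)`. -/
def dil (n : ℕ) (lam : ℝ) (g : QH n) : QH n :=
  (fun α => (lam * tC (g.1 α), lam * xC (g.1 α), lam * yC (g.1 α), lam * zC (g.1 α)),
    (lam ^ 2 * g.2.1, lam ^ 2 * g.2.2.1, lam ^ 2 * g.2.2.2))

end QH

namespace QH

section Calculus

variable {E : Type*} [NormedAddCommGroup E] [NormedSpace ℝ E]

/-- Derivative of `c f^{-m}` at a point where `f` does not vanish. -/
theorem fderiv_const_mul_inv_pow_apply {f : E → ℝ} {g : E} (hf : DifferentiableAt ℝ f g)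
    (h0 : f g ≠ 0) (c : ℝ) (m : ℕ) (v : E) :
    fderiv ℝ (fun x => c * (f x ^ m)⁻¹) g v = -(c * m) * (f g ^ (m + 1))⁻¹ * fderiv ℝ f g v := by
  have h1 : HasDerivAt (fun y : ℝ => c * (y ^ m)⁻¹)
      (c * (-(m * f g ^ (m - 1)) / (f g ^ m) ^ 2)) (f g) :=
    ((hasDerivAt_pow m (f g)).fun_inv (pow_ne_zero m h0)).const_mul c
  have h2 := (h1.comp_hasFDerivAt g hf.hasFDerivAt).fderiv
  simp only [Function.comp_def] at h2
  rw [h2]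
  simp only [smul_apply, smul_eq_mul]
  congr 1
  rcases m with _ | m
  · simp
  · simp only [Nat.add_sub_cancel]
    field_simp
    ring

/-- Second derivative of `c f^{-m}` along a vector field `V`, where `P = V f`. -/
theorem fderiv_fderiv_const_mul_inv_pow {f P : E → ℝ} {V : E → E} (hf : Differentiable ℝ f)
    (h0 : ∀ g, f g ≠ 0) (hP : Differentiable ℝ P) (hfP : ∀ g, fderiv ℝ f g (V g) = P g)
    (c : ℝ) (m : ℕ) (g : E) :
    fderiv ℝ (fun y => fderiv ℝ (fun x => c * (f x ^ m)⁻¹) y (V y)) g (V g) =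
      -(c * m) * (f g ^ (m + 1))⁻¹ * fderiv ℝ P g (V g)
        + c * m * (m + 1) * (f g ^ (m + 2))⁻¹ * P g ^ 2 := by
  have h1 : (fun y => fderiv ℝ (fun x => c * (f x ^ m)⁻¹) y (V y)) =
      fun y => (-(c * m) * (f y ^ (m + 1))⁻¹) * P y := by
    funext y
    rw [fderiv_const_mul_inv_pow_apply (hf y) (h0 y), hfP]
  have h2 : DifferentiableAt ℝ (fun y => -(c * m) * (f y ^ (m + 1))⁻¹) g :=
    (((hf g).pow (m + 1)).fun_inv (pow_ne_zero _ (h0 g))).const_mul _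
  rw [h1, fderiv_fun_mul h2 (hP g)]
  simp only [add_apply, smul_apply, smul_eq_mul]
  rw [fderiv_const_mul_inv_pow_apply (hf g) (h0 g), hfP]
  push_cast
  ring

end Calculus

variable {n : ℕ}

/-- The Euclidean inner product of two quaternion quadruples. -/
def quadDot (a b : ℝ × ℝ × ℝ × ℝ) : ℝ :=
  tC a * tC b + xC a * xC b + yC a * yC b + zC a * zC b

/-- The Euclidean inner product of two elements of `Im ℍ`. -/
def imDot (a b : ℝ × ℝ × ℝ) : ℝ := a.1 * b.1 + a.2.1 * b.2.1 + a.2.2 * b.2.2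

/-- The function `(1 + |q|²)² + |ω|²`. -/
def gauge (n : ℕ) (g : QH n) : ℝ := (1 + qSq n g) ^ 2 + wSq n g

theorem gauge_pos (g : QH n) : 0 < gauge n g := by
  have h1 : 0 ≤ qSq n g := Finset.sum_nonneg fun α _ => by positivity
  have h2 : 0 ≤ wSq n g := by unfold wSq; positivity
  unfold gauge
  positivity

theorem differentiable_qSq : Differentiable ℝ (qSq n) := by
  unfold qSq tC xC yC zC
  fun_prop

theorem differentiable_gauge : Differentiable ℝ (gauge n) := by
  have := differentiable_qSq (n := n)
  unfold gauge wSq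
  fun_prop

/-- The projection onto the `α`-th quaternionic coordinate, as a continuous linear map. -/
def coord (α : Fin n) : QH n →L[ℝ] ℝ × ℝ × ℝ × ℝ :=
  (ContinuousLinearMap.proj (R := ℝ) (φ := fun _ : Fin n => ℝ × ℝ × ℝ × ℝ) α).comp
    (ContinuousLinearMap.fst ℝ (Fin n → ℝ × ℝ × ℝ × ℝ) (ℝ × ℝ × ℝ))

@[simp]
theorem coord_apply (α : Fin n) (g : QH n) : coord α g = g.1 α := rfl

theorem hasFDerivAt_coord (α : Fin n) (g : QH n) :
    HasFDerivAt (fun g : QH n => g.1 α) (coord α) g :=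
  (coord α).hasFDerivAt

theorem fderiv_qSq_single (g : QH n) (α : Fin n) (e : ℝ × ℝ × ℝ × ℝ) (w : ℝ × ℝ × ℝ) :
    fderiv ℝ (qSq n) g (Pi.single α e, w) = 2 * quadDot (g.1 α) e := by
  have hd (β : Fin n) := hasFDerivAt_coord β g
  have h : HasFDerivAt (qSq n) _ g := HasFDerivAt.fun_sum fun β _ =>
    (((((hd β).fst).pow 2).add (((hd β).snd.fst).pow 2)).add (((hd β).snd.snd.fst).pow 2)).add
      (((hd β).snd.snd.snd).pow 2)
  rw [h.fderiv, sum_apply, Finset.sum_eq_single α]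
  · simp [quadDot, tC, xC, yC, zC]
    ring
  · intro β _ hβ
    simp [hβ]
  · simp

theorem fderiv_gauge_single (g : QH n) (α : Fin n) (e : ℝ × ℝ × ℝ × ℝ) (w : ℝ × ℝ × ℝ) :
    fderiv ℝ (gauge n) g (Pi.single α e, w) =
      4 * (1 + qSq n g) * quadDot (g.1 α) e + 2 * imDot g.2 w := by
  have hq := (differentiable_qSq g).hasFDerivAt
  have hd := hasFDerivAt_snd (𝕜 := ℝ) (p := g)
  have h : HasFDerivAt (gauge n) _ g :=
    ((hq.const_add 1).pow 2).add
      (((hd.fst.pow 2).add (hd.snd.fst.pow 2)).add (hd.snd.snd.pow 2))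
  rw [h.fderiv]
  simp [fderiv_qSq_single, imDot]
  ring

/-- The second derivative of `c ((1 + |q|²)² + |ω|²)^{-m}` along the vector field
`∂_e + A(q_α)·∂_ω`, where `e` is a vector in the `α`-th copy of `ℍ` and `A` is linear
with `A e = 0`. -/
theorem fderiv_fderiv_gauge (α : Fin n) (e : ℝ × ℝ × ℝ × ℝ)
    (A : ℝ × ℝ × ℝ × ℝ → ℝ × ℝ × ℝ) (hA : IsLinearMap ℝ A) (hAe : A e = 0)
    (c : ℝ) (m : ℕ) (V : QH n → QH n) (hV : V = fun g => (Pi.single α e, A (g.1 α)))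
    (g : QH n) :
    fderiv ℝ (fun y => fderiv ℝ (fun x => c * (gauge n x ^ m)⁻¹) y (V y)) g (V g) =
      -(c * m) * (gauge n g ^ (m + 1))⁻¹ *
          (8 * quadDot (g.1 α) e ^ 2 + 4 * (1 + qSq n g) * quadDot e e
            + 2 * imDot (A (g.1 α)) (A (g.1 α)))
        + c * m * (m + 1) * (gauge n g ^ (m + 2))⁻¹ *
          (4 * (1 + qSq n g) * quadDot (g.1 α) e + 2 * imDot g.2 (A (g.1 α))) ^ 2 := by
  subst hV
  obtain ⟨B, rfl⟩ : ∃ B : (ℝ × ℝ × ℝ × ℝ) →L[ℝ] (ℝ × ℝ × ℝ), ⇑B = A :=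
    ⟨(hA.mk' A).toContinuousLinearMap, rfl⟩
  have hd := hasFDerivAt_coord α g
  have hB := B.hasFDerivAt.comp g hd
  have hw := hasFDerivAt_snd (𝕜 := ℝ) (p := g)
  have hq := (differentiable_qSq g).hasFDerivAt
  have hP : Differentiable ℝ fun g : QH n =>
      4 * (1 + qSq n g) * quadDot (g.1 α) e + 2 * imDot g.2 (B (g.1 α)) := by
    have := differentiable_qSq (n := n)
    unfold quadDot imDot tC xC yC zC
    fun_prop
  rw [fderiv_fderiv_const_mul_inv_pow differentiable_gauge (fun g => (gauge_pos g).ne') hP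
    (fun g => fderiv_gauge_single g α e _)]
  congr 2
  have h : HasFDerivAt (fun g : QH n =>
      4 * (1 + qSq n g) * quadDot (g.1 α) e + 2 * imDot g.2 (B (g.1 α))) _ g :=
    (((hq.const_add 1).const_mul 4).mul
      ((((hd.fst.mul_const (tC e)).add (hd.snd.fst.mul_const (xC e))).add
        (hd.snd.snd.fst.mul_const (yC e))).add (hd.snd.snd.snd.mul_const (zC e)))).add
    ((((hw.fst.mul hB.fst).add (hw.snd.fst.mul hB.snd.fst)).add
      (hw.snd.snd.mul hB.snd.snd)).const_mul 2)
  rw [h.fderiv]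
  simp [fderiv_qSq_single, hAe]
  simp [quadDot, imDot, tC, xC, yC, zC]
  ring

theorem subLap_const_mul_gauge_inv_pow (c : ℝ) (m : ℕ) (g : QH n) :
    subLap n (fun x => c * (gauge n x ^ m)⁻¹) g =
      -(c * m) * (gauge n g ^ (m + 1))⁻¹ * (16 * n * (1 + qSq n g) + 32 * qSq n g)
        + c * m * (m + 1) * (gauge n g ^ (m + 1))⁻¹ * (16 * qSq n g) := by
  have hpos := gauge_pos g
  have hterm (α : Fin n) :
      TD n α (TD n α fun x => c * (gauge n x ^ m)⁻¹) g
        + XD n α (XD n α fun x => c * (gauge n x ^ m)⁻¹) g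
        + YD n α (YD n α fun x => c * (gauge n x ^ m)⁻¹) g
        + ZD n α (ZD n α fun x => c * (gauge n x ^ m)⁻¹) g =
      -(c * m) * (gauge n g ^ (m + 1))⁻¹ *
          (16 * (1 + qSq n g) + 32 * quadDot (g.1 α) (g.1 α))
        + c * m * (m + 1) * (gauge n g ^ (m + 1))⁻¹ * (16 * quadDot (g.1 α) (g.1 α)) := by
    have hT := fderiv_fderiv_gauge α (1, 0, 0, 0)
      (fun a => (2 * xC a, 2 * yC a, 2 * zC a))
      ⟨fun a b => by ext <;> simp [xC, yC, zC] <;> ring,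
        fun r a => by ext <;> simp [xC, yC, zC] <;> ring⟩
      (by simp [xC, yC, zC]) c m (Tvec n α) rfl g
    have hX := fderiv_fderiv_gauge α (0, 1, 0, 0)
      (fun a => (-2 * tC a, -2 * zC a, 2 * yC a))
      ⟨fun a b => by ext <;> simp [tC, yC, zC] <;> ring,
        fun r a => by ext <;> simp [tC, yC, zC] <;> ring⟩
      (by simp [tC, yC, zC]) c m (Xvec n α) rfl g
    have hY := fderiv_fderiv_gauge α (0, 0, 1, 0)
      (fun a => (2 * zC a, -2 * tC a, -2 * xC a))
      ⟨fun a b => by ext <;> simp [tC, xC, zC] <;> ring,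
        fun r a => by ext <;> simp [tC, xC, zC] <;> ring⟩
      (by simp [tC, xC, zC]) c m (Yvec n α) rfl g
    have hZ := fderiv_fderiv_gauge α (0, 0, 0, 1)
      (fun a => (-2 * yC a, 2 * xC a, -2 * tC a))
      ⟨fun a b => by ext <;> simp [tC, xC, yC] <;> ring,
        fun r a => by ext <;> simp [tC, xC, yC] <;> ring⟩
      (by simp [tC, xC, yC]) c m (Zvec n α) rfl g
    unfold TD XD YD ZD
    rw [hT, hX, hY, hZ]
    have hinv : (gauge n g ^ (m + 1))⁻¹ = (gauge n g ^ (m + 2))⁻¹ * gauge n g := by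
      field_simp
      ring
    nth_rewrite 6 [hinv]
    generalize (gauge n g ^ (m + 1))⁻¹ = u
    generalize (gauge n g ^ (m + 2))⁻¹ = v
    simp only [gauge, quadDot, imDot, wSq, tC, xC, yC, zC]
    ring
  have hsum : ∑ α : Fin n, quadDot (g.1 α) (g.1 α) = qSq n g :=
    Finset.sum_congr rfl fun α _ => by simp only [quadDot]; ring
  unfold subLap
  simp_rw [hterm]
  simp only [Finset.sum_add_distrib, ← Finset.mul_sum, hsum, Finset.sum_const, Finset.card_univ, Fintype.card_fin, nsmul_eq_mul]
  ring

end QH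

/-- `Φ` solves the qc Yamabe equation on the quaternionic Heisenberg
group.  For `Φ(q,ω) = 8^{n+1}[(1+|q|²)² + |ω|²]^{−(n+1)}` one has
`ΔΦ = −K Φ^{(Q+2)/(Q−2)}` with `Q = 4n+6` and `K = (Q−2)(Q−6)/8 = 2n(n+1)`. -/
theorem Phi_solves_yamabe (n : ℕ) (hn : 1 ≤ n)
    (Q K : ℝ)
    (hQ : Q = 4 * n + 6)
    (hK : K = (Q - 2) * (Q - 6) / 8)
    (Φ : QH n → ℝ)
    (hΦ : Φ = fun g => 8 ^ (n + 1) * (((1 + QH.qSq n g) ^ 2 + QH.wSq n g) ^ (n + 1))⁻¹) :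
    ∀ g : QH n, QH.subLap n Φ g = -K * Φ g ^ ((Q + 2) / (Q - 2)) := by
  intro g
  have hn' : (0 : ℝ) < n := by exact_mod_cast hn
  have hpos := QH.gauge_pos g
  have hexp : (Q + 2) / (Q - 2) = ((n + 2 : ℕ) : ℝ) / ((n + 1 : ℕ) : ℝ) := by
    subst hQ
    push_cast
    rw [div_eq_div_iff (by linarith) (by linarith)]
    ring
  have hΦg : Φ g = (8 * (QH.gauge n g)⁻¹) ^ (n + 1) := by
    rw [hΦ, mul_pow, inv_pow]
    rfl
  have hbase : 0 ≤ 8 * (QH.gauge n g)⁻¹ := by positivity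
  have hpow : Φ g ^ ((Q + 2) / (Q - 2)) = (8 * (QH.gauge n g)⁻¹) ^ (n + 2) := by
    rw [hΦg, hexp, ← Real.rpow_natCast, ← Real.rpow_mul hbase, mul_div_cancel₀ _ (by positivity),
      Real.rpow_natCast]
  have hL : QH.subLap n Φ g = _ := hΦ ▸ QH.subLap_const_mul_gauge_inv_pow (8 ^ (n + 1)) (n + 1) g
  rw [hL, hpow, hK, hQ, mul_pow, inv_pow]
  push_cast
  ring
end

section
/- Let n ≥ 0, r ∈ (0,1], and (q,p) ∈ ℍⁿ × ℍ with |q|² + |p|² = 1. Set A = (1+p) + r²(1−p) and B = (1+p) − r²(1−p). Then A ≠ 0, and the point ψ_r(q,p) = (2r A⁻¹ q, A⁻¹ B) again lies on the unit sphere: |2r A⁻¹ q|² + |A⁻¹ B|² = 1. Moreover ψ_1 is the identity map of the sphere. -/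
open scoped Quaternion

/-- The squared norms of `(1 + p) ± c(1 - p)` differ by `4c(1 - |p|²)`. -/
lemma norm_sq_one_add_add_smul_one_sub (c : ℝ) (p : ℍ[ℝ]) :
    ‖(1 + p) + c • (1 - p)‖ ^ 2 = ‖(1 + p) - c • (1 - p)‖ ^ 2 + 4 * c * (1 - ‖p‖ ^ 2) := by
  simp only [sq, ← Quaternion.normSq_eq_norm_mul_self, Quaternion.normSq_def']
  simp
  ring

/-- The real part of `(1 + p) + c(1 - p)` is positive on the unit ball when `0 < c ≤ 1`. -/
lemma one_add_add_smul_one_sub_ne_zero {c : ℝ} (hc : 0 < c) (hc1 : c ≤ 1) {p : ℍ[ℝ]}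
    (hp : ‖p‖ ^ 2 ≤ 1) : (1 + p) + c • (1 - p) ≠ 0 := by
  intro h
  have hre := congrArg (fun x : ℍ[ℝ] => x.re) h
  simp at hre
  rw [sq, ← Quaternion.normSq_eq_norm_mul_self, Quaternion.normSq_def'] at hp
  have hp1 : -1 ≤ p.re := by
    nlinarith [sq_nonneg p.imI, sq_nonneg p.imJ, sq_nonneg p.imK]
  nlinarith [mul_nonneg (sub_nonneg.2 hc1) (neg_le_iff_add_nonneg.1 hp1)]

/-- the conformal maps `ψ_r` preserve the unit sphere.  For
`r ∈ (0,1]` and `(q,p)` on the unit sphere of `ℍⁿ × ℍ`, with `A = (1+p) + r²(1−p)` and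
`B = (1+p) − r²(1−p)`, one has `A ≠ 0` and `|2r A⁻¹ q|² + |A⁻¹ B|² = 1`; moreover `ψ_1` is
the identity map of the sphere. -/
theorem psi_r_preserves_sphere (n : ℕ) (r : ℝ) (hr : r ∈ Set.Ioc (0 : ℝ) 1)
    (q : Fin n → ℍ[ℝ]) (p : ℍ[ℝ])
    (hsphere : (∑ i : Fin n, ‖q i‖ ^ 2) + ‖p‖ ^ 2 = 1)
    (A B : ℍ[ℝ])
    (hA : A = (1 + p) + r ^ 2 • (1 - p))
    (hB : B = (1 + p) - r ^ 2 • (1 - p)) :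
    A ≠ 0 ∧
    ((∑ i : Fin n, ‖(2 * r) • (A⁻¹ * q i)‖ ^ 2) + ‖A⁻¹ * B‖ ^ 2 = 1) ∧
    (r = 1 → (∀ i : Fin n, (2 * r) • (A⁻¹ * q i) = q i) ∧ A⁻¹ * B = p) := by
  obtain ⟨hr0, hr1⟩ := hr
  have hp : ‖p‖ ^ 2 ≤ 1 := by
    have : 0 ≤ ∑ i : Fin n, ‖q i‖ ^ 2 := by positivity
    linarith
  have hA0 : A ≠ 0 := by
    rw [hA]
    exact one_add_add_smul_one_sub_ne_zero (by positivity) (pow_le_one₀ hr0.le hr1) hp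
  refine ⟨hA0, ?_, ?_⟩
  · have hAB : ‖A‖ ^ 2 = ‖B‖ ^ 2 + 4 * r ^ 2 * (1 - ‖p‖ ^ 2) := by
      rw [hA, hB]
      exact norm_sq_one_add_add_smul_one_sub _ p
    have hq : ∑ i : Fin n, ‖(2 * r) • (A⁻¹ * q i)‖ ^ 2
        = 4 * r ^ 2 * (‖A‖ ^ 2)⁻¹ * ∑ i : Fin n, ‖q i‖ ^ 2 := by
      rw [Finset.mul_sum]
      refine Finset.sum_congr rfl fun i _ => ?_
      rw [norm_smul, norm_mul A⁻¹, norm_inv, mul_pow, mul_pow, Real.norm_eq_abs, sq_abs, inv_pow]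
      ring
    have hA2 : ‖A‖ ≠ 0 := norm_ne_zero_iff.2 hA0
    rw [hq, norm_mul, norm_inv, eq_sub_of_add_eq hsphere]
    field_simp
    linarith
  · rintro rfl
    have hA2 : A = ((2 : ℝ) : ℍ[ℝ]) := by
      rw [hA]
      ext <;> simp
      norm_num
    have hB2 : B = (2 : ℝ) • p := by
      rw [hB, one_pow, one_smul, two_smul]
      abel
    rw [hA2, hB2]
    refine ⟨fun i => ?_, ?_⟩ <;>
      simp [-Quaternion.coe_inv, ← Quaternion.coe_inv, Quaternion.coe_mul_eq_smul, smul_smul]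
end
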